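/- Let α, ℓ > 0. Assume C > 0 and h₀ ∈ (0,1] are such that for every closed interval Ω ⊂ ℝ of length 1 and every finite X ⊂ ℝ with X ∩ Ω ≠ ∅ and h_{X,Ω} ≤ h₀ one has ∫_Ω P_{ℓ,X}(x) dx ≤ exp(C log(h_{X,Ω}) / h_{X,Ω}). Let c_qu > 0 and let X_k be the point sets built with n̄_m = m, so that #X_k = n = k(k+1), and set h̄₀ = min{h₀, 1/c_qu}. Then there is a positive constant C', depending only on ℓ, α, c_qu and C, such that e^{opt}_{α,ℓ}(X_k) ≤ C' exp(−√n/(2√2 α²)) whenever k ≥ 2 c_qu/h̄₀. -/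

import Mathlib

open MeasureTheory Real Filter

noncomputable section

/-- The orthonormal basis functions of the Gaussian RKHS. -/
def phi (ℓ : ℝ) (m : ℕ) (x : ℝ) : ℝ :=
  x ^ m * Real.exp (-x ^ 2 / (2 * ℓ ^ 2)) / (ℓ ^ m * Real.sqrt (Nat.factorial m))

/-- The univariate Gaussian integral functional. -/
def Igauss (α : ℝ) (f : ℝ → ℝ) : ℝ :=
  (Real.sqrt (2 * Real.pi) * α)⁻¹ * ∫ x : ℝ, f x * Real.exp (-x ^ 2 / (2 * α ^ 2))

/-- β = αℓ/√(α² + ℓ²). -/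
def betaP (α ℓ : ℝ) : ℝ := α * ℓ / Real.sqrt (α ^ 2 + ℓ ^ 2)

/-- C_n = 2^n n! n^{−1/4} / √((2n)!). -/
def Cseq (n : ℕ) : ℝ :=
  2 ^ n * (Nat.factorial n : ℝ) * (n : ℝ) ^ (-(1 / 4 : ℝ)) / Real.sqrt (Nat.factorial (2 * n))

/-- ω_γ = 2γ²/(1 + 2γ² + √(1+4γ²)). -/
def omegaP (γ : ℝ) : ℝ := 2 * γ ^ 2 / (1 + 2 * γ ^ 2 + Real.sqrt (1 + 4 * γ ^ 2))

/-- C̄_n(γ). -/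
def Cbar (γ : ℝ) (n : ℕ) : ℝ :=
  Real.sqrt (2 * (1 + 4 * γ ^ 2) ^ ((1 : ℝ) / 4) /
      ((1 + 2 * γ ^ 2 + Real.sqrt (1 + 4 * γ ^ 2)) * Real.exp 1)) *
    ((Nat.factorial n : ℝ) / (Nat.factorial (2 * n) : ℝ)) *
    (Real.exp 1 / (4 * (n : ℝ))) ^ (-(n : ℤ))

/-- `x`, `w` are the nodes and weights of the n-point Gauss–Hermite rule: the nodes are the
n distinct roots of the probabilists' Hermite polynomial H_n, the weights are positive, and
the rule integrates exactly all polynomials of degree at most 2n−1 against the standard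
Gaussian weight. -/
def IsGaussHermite (n : ℕ) (x w : Fin n → ℝ) : Prop :=
  Function.Injective x ∧
  (∀ i, Polynomial.aeval (x i) (Polynomial.hermite n) = 0) ∧
  (∀ i, 0 < w i) ∧
  ∀ p : Polynomial ℝ, p.natDegree ≤ 2 * n - 1 →
    ∑ i, w i * p.eval (x i)
      = (Real.sqrt (2 * Real.pi))⁻¹ * ∫ t : ℝ, p.eval t * Real.exp (-t ^ 2 / 2)

/-- The scaled Gauss–Hermite rule Q_{α,ℓ,n}^{GH}. -/
def QGH (α ℓ : ℝ) {n : ℕ} (x w : Fin n → ℝ) (f : ℝ → ℝ) : ℝ :=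
  betaP α ℓ / α *
    ∑ i, w i * Real.exp (betaP α ℓ ^ 2 * x i ^ 2 / (2 * ℓ ^ 2)) * f (betaP α ℓ * x i)

/-- Membership in the unit ball of the Gaussian RKHS H(K_ℓ). -/
def InBall (ℓ : ℝ) (f : ℝ → ℝ) : Prop :=
  ∃ c : ℕ → ℝ, (∀ x, HasSum (fun m => c m * phi ℓ m x) (f x)) ∧
    Summable (fun m => c m ^ 2) ∧ (∑' m, c m ^ 2) ≤ 1

/-- Worst-case error of a quadrature functional over the unit ball of H(K_ℓ). -/
def wce1 (α ℓ : ℝ) (Q : (ℝ → ℝ) → ℝ) : ℝ :=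
  sSup {e : ℝ | ∃ f : ℝ → ℝ, InBall ℓ f ∧ e = |Igauss α f - Q f|}

/-- The n-th minimal worst-case error (univariate). -/
def minErr1 (α ℓ : ℝ) (n : ℕ) : ℝ :=
  ⨅ p : (Fin n → ℝ) × (Fin n → ℝ), wce1 α ℓ fun f => ∑ i, p.2 i * f (p.1 i)

/-- The multivariate Gaussian integral functional. -/
def IgaussD {d : ℕ} (α : Fin d → ℝ) (f : (Fin d → ℝ) → ℝ) : ℝ :=
  ∫ x : Fin d → ℝ,
    f x * ∏ i, (Real.sqrt (2 * Real.pi) * α i)⁻¹ * Real.exp (-(x i) ^ 2 / (2 * α i ^ 2))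

/-- Membership in the unit ball of the tensor-product Gaussian RKHS H(K_ℓ), ℓ ∈ ℝ^d. -/
def InBallD {d : ℕ} (ℓ : Fin d → ℝ) (f : (Fin d → ℝ) → ℝ) : Prop :=
  ∃ c : (Fin d → ℕ) → ℝ,
    (∀ x, HasSum (fun m => c m * ∏ i, phi (ℓ i) (m i) (x i)) (f x)) ∧
    Summable (fun m => c m ^ 2) ∧ (∑' m, c m ^ 2) ≤ 1

/-- Worst-case error of a multivariate quadrature functional. -/
def wceD {d : ℕ} (α ℓ : Fin d → ℝ) (Q : ((Fin d → ℝ) → ℝ) → ℝ) : ℝ :=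
  sSup {e : ℝ | ∃ f, InBallD ℓ f ∧ e = |IgaussD α f - Q f|}

/-- The N-th minimal worst-case error in dimension d. -/
def minErrD {d : ℕ} (α ℓ : Fin d → ℝ) (N : ℕ) : ℝ :=
  ⨅ p : (Fin N → (Fin d → ℝ)) × (Fin N → ℝ), wceD α ℓ fun f => ∑ i, p.2 i * f (p.1 i)

/-- The tensor-product scaled Gauss–Hermite rule. -/
def QGHD {d : ℕ} (α ℓ : Fin d → ℝ) (n : Fin d → ℕ)
    (x w : ∀ j, Fin (n j) → ℝ) (f : (Fin d → ℝ) → ℝ) : ℝ :=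
  ∑ i : ∀ j, Fin (n j),
    (∏ j, betaP (α j) (ℓ j) / α j * w j (i j) *
        Real.exp (betaP (α j) (ℓ j) ^ 2 * x j (i j) ^ 2 / (2 * ℓ j ^ 2))) *
      f fun j => betaP (α j) (ℓ j) * x j (i j)

/-- The power function of a finite point set (univariate). -/
def power1 (ℓ : ℝ) (X : Finset ℝ) (x : ℝ) : ℝ :=
  sSup {v : ℝ | ∃ f, InBall ℓ f ∧ (∀ y ∈ X, f y = 0) ∧ v = f x}

/-- Fill distance of X on Ω (univariate). -/
def fillDist1 (X : Finset ℝ) (Ω : Set ℝ) : ℝ :=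
  sSup {h : ℝ | ∃ x ∈ Ω, h = sInf {r : ℝ | ∃ y ∈ X, y ∈ Ω ∧ r = |x - y|}}

/-- Euclidean distance on ℝ^d. -/
def eucDist {d : ℕ} (x y : Fin d → ℝ) : ℝ := Real.sqrt (∑ i, (x i - y i) ^ 2)

/-- The power function of a finite point set in ℝ^d for the isotropic Gaussian kernel. -/
def powerD {d : ℕ} (ℓ : ℝ) (X : Finset (Fin d → ℝ)) (x : Fin d → ℝ) : ℝ :=
  sSup {v : ℝ | ∃ f, InBallD (fun _ => ℓ) f ∧ (∀ y ∈ X, f y = 0) ∧ v = f x}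

/-- Fill distance of X on Ω ⊂ ℝ^d (Euclidean). -/
def fillDistD {d : ℕ} (X : Finset (Fin d → ℝ)) (Ω : Set (Fin d → ℝ)) : ℝ :=
  sSup {h : ℝ | ∃ x ∈ Ω, h = sInf {r : ℝ | ∃ y ∈ X, y ∈ Ω ∧ r = eucDist x y}}

/-- Worst-case error of the optimal-weight (kernel quadrature) rule with nodes X (univariate). -/
def eopt1 (α ℓ : ℝ) (X : Finset ℝ) : ℝ :=
  ⨅ w : ℝ → ℝ, wce1 α ℓ fun f => ∑ y ∈ X, w y * f y

/-- Worst-case error of the optimal-weight rule with nodes X ⊂ ℝ^d. -/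
def eoptD {d : ℕ} (α ℓ : Fin d → ℝ) (X : Finset (Fin d → ℝ)) : ℝ :=
  ⨅ w : (Fin d → ℝ) → ℝ, wceD α ℓ fun f => ∑ y ∈ X, w y * f y

/-- The point sets X_k = ∪_{m=1}^k (Y_{k−m+1}^{m,+} ∪ Y_{k−m+1}^{m,−}). -/
def Xk (Y : ℕ → Finset ℝ) (k : ℕ) : Finset ℝ :=
  (Finset.Icc 1 k).biUnion fun m =>
    ((Y (k - m + 1)).image fun x => x + (m : ℝ) - 1) ∪
      ((Y (k - m + 1)).image fun x => x - (m : ℝ))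


lemma hasSum_phi_mul_phi {ℓ : ℝ} (hℓ : 0 < ℓ) (x y : ℝ) :
    HasSum (fun m => phi ℓ m x * phi ℓ m y) (Real.exp (-(x - y) ^ 2 / (2 * ℓ ^ 2))) := by
  have h := (NormedSpace.expSeries_div_hasSum_exp (x * y / ℓ ^ 2)).mul_left
    (Real.exp (-x ^ 2 / (2 * ℓ ^ 2)) * Real.exp (-y ^ 2 / (2 * ℓ ^ 2)))
  rw [← Real.exp_eq_exp_ℝ] at h
  convert! h using 1
  · funext m
    have hf : Real.sqrt (Nat.factorial m) * Real.sqrt (Nat.factorial m) = Nat.factorial m :=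
      Real.mul_self_sqrt (by positivity)
    have hden : ℓ ^ m * Real.sqrt (Nat.factorial m) * (ℓ ^ m * Real.sqrt (Nat.factorial m)) =
        (ℓ ^ 2) ^ m * Nat.factorial m := by
      rw [mul_mul_mul_comm, hf, ← mul_pow, ← pow_two]
    unfold phi
    rw [div_mul_div_comm, hden, div_pow, mul_pow, div_div]
    ring
  · rw [← Real.exp_add, ← Real.exp_add]
    congr 1
    field_simp
    ring

/-- The coefficient sequence `m ↦ φ_{ℓ,m}(x)` of the kernel translate at `x`. -/
def kernelVec {ℓ : ℝ} (hℓ : 0 < ℓ) (x : ℝ) : lp (fun _ : ℕ => ℝ) 2 :=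
  ⟨fun m => phi ℓ m x, memℓp_gen (by
    simpa [← pow_two] using (hasSum_phi_mul_phi hℓ x x).summable)⟩

lemma inner_kernelVec {ℓ : ℝ} (hℓ : 0 < ℓ) (x y : ℝ) :
    inner ℝ (kernelVec hℓ x) (kernelVec hℓ y) = Real.exp (-(x - y) ^ 2 / (2 * ℓ ^ 2)) := by
  refine (lp.hasSum_inner _ _).unique ?_
  simpa [kernelVec, mul_comm] using hasSum_phi_mul_phi hℓ x y

lemma norm_kernelVec {ℓ : ℝ} (hℓ : 0 < ℓ) (x : ℝ) : ‖kernelVec hℓ x‖ = 1 := by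
  rw [norm_eq_sqrt_real_inner, inner_kernelVec]
  simp

lemma continuous_kernelVec {ℓ : ℝ} (hℓ : 0 < ℓ) : Continuous (kernelVec hℓ) := by
  rw [continuous_iff_continuousAt]
  intro x
  rw [ContinuousAt, tendsto_iff_norm_sub_tendsto_zero]
  have h : ∀ y, ‖kernelVec hℓ y - kernelVec hℓ x‖
      = Real.sqrt (2 - 2 * Real.exp (-(y - x) ^ 2 / (2 * ℓ ^ 2))) := by
    intro y
    rw [← inner_kernelVec hℓ, ← Real.sqrt_sq (norm_nonneg (_ - _)), norm_sub_sq_real,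
      norm_kernelVec, norm_kernelVec]
    congr 1
    ring
  simp_rw [h]
  have hc : Continuous fun y : ℝ =>
      Real.sqrt (2 - 2 * Real.exp (-(y - x) ^ 2 / (2 * ℓ ^ 2))) := by fun_prop
  simpa using hc.tendsto x

lemma inBall_iff {ℓ : ℝ} (hℓ : 0 < ℓ) (f : ℝ → ℝ) :
    InBall ℓ f ↔ ∃ c : lp (fun _ : ℕ => ℝ) 2, ‖c‖ ≤ 1 ∧ f = fun x => inner ℝ (kernelVec hℓ x) c := by
  have key : ∀ (c : lp (fun _ : ℕ => ℝ) 2) (x : ℝ),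
      HasSum (fun m => c m * phi ℓ m x) (inner ℝ (kernelVec hℓ x) c) := by
    intro c x
    simpa [kernelVec, mul_comm] using lp.hasSum_inner (𝕜 := ℝ) (kernelVec hℓ x) c
  have hsq : ∀ c : lp (fun _ : ℕ => ℝ) 2, HasSum (fun m => c m ^ 2) (‖c‖ ^ 2) := by
    intro c
    rw [← real_inner_self_eq_norm_sq]
    simpa [pow_two] using lp.hasSum_inner (𝕜 := ℝ) c c
  constructor
  · rintro ⟨c, hc, hs, h1⟩
    let d : lp (fun _ : ℕ => ℝ) 2 := ⟨c, memℓp_gen (by simpa using hs)⟩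
    refine ⟨d, ?_, funext fun x => (hc x).unique (key d x)⟩
    have := (hsq d).tsum_eq
    have h2 : ‖d‖ ^ 2 ≤ 1 := this ▸ h1
    exact (sq_le_one_iff₀ (norm_nonneg _)).1 h2
  · rintro ⟨c, hc, rfl⟩
    refine ⟨c, fun x => key c x, (hsq c).summable, ?_⟩
    rw [(hsq c).tsum_eq]
    exact (sq_le_one_iff₀ (norm_nonneg _)).2 hc

lemma abs_inner_kernelVec_le {ℓ : ℝ} (hℓ : 0 < ℓ) (x : ℝ) (c : lp (fun _ : ℕ => ℝ) 2) :
    |inner ℝ (kernelVec hℓ x) c| ≤ ‖c‖ := by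
  simpa [norm_kernelVec] using abs_real_inner_le_norm (kernelVec hℓ x) c

lemma one_mem_upperBounds_power1 {ℓ : ℝ} (hℓ : 0 < ℓ) (X : Finset ℝ) (x : ℝ) :
    1 ∈ upperBounds {v : ℝ | ∃ f, InBall ℓ f ∧ (∀ y ∈ X, f y = 0) ∧ v = f x} := by
  rintro v ⟨f, hf, -, rfl⟩
  obtain ⟨c, hc, rfl⟩ := (inBall_iff hℓ f).1 hf
  exact (le_abs_self _).trans ((abs_inner_kernelVec_le hℓ x c).trans hc)

lemma inner_le_power1 {ℓ : ℝ} (hℓ : 0 < ℓ) (X : Finset ℝ) (x : ℝ)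
    {c : lp (fun _ : ℕ => ℝ) 2} (hc : ‖c‖ ≤ 1) (h0 : ∀ y ∈ X, inner ℝ (kernelVec hℓ y) c = 0) :
    inner ℝ (kernelVec hℓ x) c ≤ power1 ℓ X x :=
  le_csSup ⟨1, one_mem_upperBounds_power1 hℓ X x⟩ ⟨_, (inBall_iff hℓ _).2 ⟨c, hc, rfl⟩, h0, rfl⟩

lemma abs_inner_le_power1 {ℓ : ℝ} (hℓ : 0 < ℓ) (X : Finset ℝ) (x : ℝ)
    {c : lp (fun _ : ℕ => ℝ) 2} (hc : ‖c‖ ≤ 1) (h0 : ∀ y ∈ X, inner ℝ (kernelVec hℓ y) c = 0) :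
    |inner ℝ (kernelVec hℓ x) c| ≤ power1 ℓ X x := by
  refine abs_le'.2 ⟨inner_le_power1 hℓ X x hc h0, ?_⟩
  have := inner_le_power1 hℓ X x (c := -c) (by simpa using hc) (by simpa using h0)
  simpa using this

lemma power1_nonneg {ℓ : ℝ} (hℓ : 0 < ℓ) (X : Finset ℝ) (x : ℝ) : 0 ≤ power1 ℓ X x := by
  simpa using inner_le_power1 hℓ X x (c := 0) (by simp) (by simp)

lemma nonempty_power1 {ℓ : ℝ} (hℓ : 0 < ℓ) (X : Finset ℝ) (x : ℝ) :
    {v : ℝ | ∃ f, InBall ℓ f ∧ (∀ y ∈ X, f y = 0) ∧ v = f x}.Nonempty :=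
  ⟨_, _, (inBall_iff hℓ _).2 ⟨0, by simp, rfl⟩, by simp, rfl⟩

lemma power1_le_one {ℓ : ℝ} (hℓ : 0 < ℓ) (X : Finset ℝ) (x : ℝ) : power1 ℓ X x ≤ 1 :=
  csSup_le (nonempty_power1 hℓ X x) (one_mem_upperBounds_power1 hℓ X x)

lemma power1_le_add {ℓ : ℝ} (hℓ : 0 < ℓ) (X : Finset ℝ) (x y : ℝ) :
    power1 ℓ X x ≤ power1 ℓ X y + ‖kernelVec hℓ x - kernelVec hℓ y‖ := by
  refine csSup_le (nonempty_power1 hℓ X x) ?_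
  rintro v ⟨f, hf, h0, rfl⟩
  obtain ⟨c, hc, rfl⟩ := (inBall_iff hℓ f).1 hf
  have h1 := inner_le_power1 hℓ X y hc h0
  have h2 := real_inner_le_norm (kernelVec hℓ x - kernelVec hℓ y) c
  rw [inner_sub_left] at h2
  have h3 := mul_le_of_le_one_right (norm_nonneg (kernelVec hℓ x - kernelVec hℓ y)) hc
  simp only
  linarith

lemma continuous_power1 {ℓ : ℝ} (hℓ : 0 < ℓ) (X : Finset ℝ) : Continuous (power1 ℓ X) := by
  rw [continuous_iff_continuousAt]
  intro x
  have hk : Tendsto (fun y => ‖kernelVec hℓ y - kernelVec hℓ x‖) (nhds x) (nhds 0) :=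
    tendsto_iff_norm_sub_tendsto_zero.1 ((continuous_kernelVec hℓ).tendsto x)
  rw [ContinuousAt, tendsto_iff_norm_sub_tendsto_zero]
  refine squeeze_zero (fun _ => norm_nonneg _) (fun y => ?_) hk
  rw [Real.norm_eq_abs, abs_sub_le_iff]
  have h1 := power1_le_add hℓ X x y
  have h2 := power1_le_add hℓ X y x
  rw [norm_sub_rev] at h1
  constructor <;> linarith

lemma integrable_gauss_weight {α : ℝ} (hα : 0 < α) :
    Integrable fun x : ℝ => Real.exp (-x ^ 2 / (2 * α ^ 2)) := by
  have := integrable_exp_neg_mul_sq (b := (2 * α ^ 2)⁻¹) (by positivity)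
  refine this.congr (Eventually.of_forall fun x => ?_)
  simp only
  congr 1
  ring

lemma integrable_mul_gauss_weight {α : ℝ} (hα : 0 < α) {f : ℝ → ℝ} (hf : Continuous f) {B : ℝ}
    (hB : ∀ x, |f x| ≤ B) : Integrable fun x => f x * Real.exp (-x ^ 2 / (2 * α ^ 2)) :=
  (integrable_gauss_weight hα).bdd_mul (c := B) hf.aestronglyMeasurable (Eventually.of_forall hB)

lemma gauss_normalization {α : ℝ} (hα : 0 < α) :
    ∫ x : ℝ, Real.exp (-x ^ 2 / (2 * α ^ 2)) = Real.sqrt (2 * Real.pi) * α := by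
  have h := integral_gaussian (2 * α ^ 2)⁻¹
  rw [div_inv_eq_mul, show Real.pi * (2 * α ^ 2) = 2 * Real.pi * α ^ 2 by ring,
    Real.sqrt_mul (by positivity), Real.sqrt_sq hα.le] at h
  rw [← h]
  refine integral_congr_ae (Eventually.of_forall fun x => ?_)
  simp only
  congr 1
  ring

lemma continuous_inner_kernelVec {ℓ : ℝ} (hℓ : 0 < ℓ) (c : lp (fun _ : ℕ => ℝ) 2) :
    Continuous fun x => inner ℝ (kernelVec hℓ x) c :=
  (continuous_kernelVec hℓ).inner continuous_const

/-- The Gaussian integral as a linear functional on coefficient sequences. -/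
def gaussFunctional {α ℓ : ℝ} (hα : 0 < α) (hℓ : 0 < ℓ) : lp (fun _ : ℕ => ℝ) 2 →ₗ[ℝ] ℝ where
  toFun c := Igauss α fun x => inner ℝ (kernelVec hℓ x) c
  map_add' c d := by
    simp only [Igauss, inner_add_right, add_mul]
    rw [integral_add, mul_add]
    · exact integrable_mul_gauss_weight hα (continuous_inner_kernelVec hℓ c)
        fun x => abs_inner_kernelVec_le hℓ x c
    · exact integrable_mul_gauss_weight hα (continuous_inner_kernelVec hℓ d)
        fun x => abs_inner_kernelVec_le hℓ x d
  map_smul' r c := by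
    simp only [Igauss, real_inner_smul_right, mul_assoc, integral_const_mul, smul_eq_mul,
      RingHom.id_apply]
    ring

lemma abs_Igauss_le {α ℓ : ℝ} (hα : 0 < α) (hℓ : 0 < ℓ) (X : Finset ℝ)
    {c : lp (fun _ : ℕ => ℝ) 2} (hc : ‖c‖ ≤ 1) (h0 : ∀ y ∈ X, inner ℝ (kernelVec hℓ y) c = 0) :
    |Igauss α fun x => inner ℝ (kernelVec hℓ x) c| ≤ Igauss α (power1 ℓ X) := by
  unfold Igauss
  have hp : 0 < (Real.sqrt (2 * Real.pi) * α)⁻¹ := by positivity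
  rw [abs_mul, abs_of_pos hp]
  gcongr
  rw [← Real.norm_eq_abs]
  refine norm_integral_le_of_norm_le ?_ (Eventually.of_forall fun x => ?_)
  · refine integrable_mul_gauss_weight hα (continuous_power1 hℓ X) (B := 1) fun x => ?_
    rw [abs_of_nonneg (power1_nonneg hℓ X x)]
    exact power1_le_one hℓ X x
  · rw [norm_mul, Real.norm_of_nonneg (Real.exp_pos _).le]
    gcongr
    exact abs_inner_le_power1 hℓ X x hc h0

lemma eopt1_le_Igauss_power1 {α ℓ : ℝ} (hα : 0 < α) (hℓ : 0 < ℓ) (X : Finset ℝ) :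
    eopt1 α ℓ X ≤ Igauss α (power1 ℓ X) := by
  classical
  let V : Submodule ℝ (lp (fun _ : ℕ => ℝ) 2) := Submodule.span ℝ (kernelVec hℓ '' (X : Set ℝ))
  have : FiniteDimensional ℝ V := FiniteDimensional.span_of_finite ℝ (X.finite_toSet.image _)
  let L := gaussFunctional hα hℓ
  have hmem : L ∘ₗ (V.starProjection : lp (fun _ : ℕ => ℝ) 2 →ₗ[ℝ] lp (fun _ : ℕ => ℝ) 2) ∈
      Submodule.span ℝ (Set.range fun y : X => (innerₛₗ ℝ (kernelVec hℓ (y : ℝ)))) := by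
    refine mem_span_of_iInf_ker_le_ker fun c hc => ?_
    have hcV : c ∈ Vᗮ := by
      rw [Submodule.mem_orthogonal]
      intro u hu
      induction hu using Submodule.span_induction with
      | mem u hu =>
        obtain ⟨y, hy, rfl⟩ := hu
        simpa using (Submodule.mem_iInf _).1 hc ⟨y, hy⟩
      | zero => simp
      | add u v _ _ hu hv => rw [inner_add_left, hu, hv, add_zero]
      | smul r u _ hu => rw [real_inner_smul_left, hu, mul_zero]
    have h0 : V.starProjection c = 0 := by
      rw [← V.ker_starProjection] at hcV
      exact hcV
    simp [h0]
  obtain ⟨w, hw⟩ := (Submodule.mem_span_range_iff_exists_fun ℝ).1 hmem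
  let w' : ℝ → ℝ := fun y => if h : y ∈ X then w ⟨y, h⟩ else 0
  have hsum : ∀ c, ∑ y ∈ X, w' y * inner ℝ (kernelVec hℓ y) c = L (V.starProjection c) := by
    intro c
    have := congrArg (fun T => T c) hw
    simp only [LinearMap.sum_apply, LinearMap.smul_apply, LinearMap.comp_apply] at this
    rw [← Finset.sum_coe_sort]
    simpa [w'] using this
  have hbdd : BddBelow (Set.range fun w : ℝ → ℝ => wce1 α ℓ fun f => ∑ y ∈ X, w y * f y) := by
    refine ⟨0, ?_⟩
    rintro _ ⟨w, rfl⟩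
    refine Real.sSup_nonneg ?_
    rintro _ ⟨f, -, rfl⟩
    exact abs_nonneg _
  refine (ciInf_le hbdd w').trans (csSup_le ⟨_, _, (inBall_iff hℓ _).2 ⟨0, by simp, rfl⟩, rfl⟩ ?_)
  rintro _ ⟨f, hf, rfl⟩
  obtain ⟨c, hc, rfl⟩ := (inBall_iff hℓ f).1 hf
  beta_reduce
  rw [hsum, show (Igauss α fun x => inner ℝ (kernelVec hℓ x) c) = L c from rfl, ← map_sub]
  refine abs_Igauss_le hα hℓ X ?_ fun y hy => ?_
  · have h := Submodule.starProjection_orthogonal_val (K := V) c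
    rw [← h]
    exact (Submodule.norm_starProjection_apply_le _ c).trans hc
  · exact (Submodule.mem_orthogonal _ _).1 (Submodule.sub_starProjection_mem_orthogonal c) _
      (Submodule.subset_span ⟨y, hy, rfl⟩)

lemma fillDist1_translate_le {X Y : Finset ℝ} {a : ℝ} (hne : Y.Nonempty)
    (hY : (Y : Set ℝ) ⊆ Set.Ioo (0 : ℝ) 1) (hX : ∀ y ∈ Y, a + y ∈ X) :
    fillDist1 X (Set.Icc a (a + 1)) ≤ fillDist1 Y (Set.Ioo 0 1) := by
  have hbdd : ∀ (Z : Finset ℝ) (Ω : Set ℝ) (x : ℝ),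
      BddBelow {r : ℝ | ∃ y ∈ Z, y ∈ Ω ∧ r = |x - y|} := fun Z Ω x =>
    ⟨0, by rintro _ ⟨y, -, -, rfl⟩; exact abs_nonneg _⟩
  refine csSup_le (Set.nonempty_of_mem ⟨a, by simp, rfl⟩) ?_
  rintro _ ⟨x, hx, rfl⟩
  refine le_of_forall_pos_le_add fun ε hε => ?_
  have hcl : x - a ∈ closure (Set.Ioo (0 : ℝ) 1) := by
    rw [closure_Ioo zero_ne_one]
    exact ⟨by linarith [hx.1], by linarith [hx.2]⟩
  obtain ⟨t, ht, hxt⟩ := Metric.mem_closure_iff.1 hcl (ε / 2) (by positivity)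
  obtain ⟨y₀, hy₀⟩ := hne
  have hup : BddAbove {h : ℝ | ∃ x ∈ Set.Ioo (0 : ℝ) 1,
      h = sInf {r : ℝ | ∃ y ∈ Y, y ∈ Set.Ioo (0 : ℝ) 1 ∧ r = |x - y|}} := by
    refine ⟨1, ?_⟩
    rintro _ ⟨x, hx, rfl⟩
    refine (csInf_le (hbdd _ _ _) ⟨y₀, hy₀, hY hy₀, rfl⟩).trans ?_
    have := hY hy₀
    rw [abs_le]
    constructor <;> linarith [hx.1, hx.2, this.1, this.2]
  have hle := le_csSup hup ⟨t, ht, rfl⟩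
  obtain ⟨_, ⟨y, hy, hy01, rfl⟩, hlt⟩ := exists_lt_of_csInf_lt
    (Set.nonempty_of_mem (s := {r : ℝ | ∃ y ∈ Y, y ∈ Set.Ioo (0 : ℝ) 1 ∧ r = |t - y|})
      ⟨y₀, hy₀, hY hy₀, rfl⟩)
    (show _ < fillDist1 Y (Set.Ioo 0 1) + ε / 2 by
      refine lt_of_le_of_lt hle ?_
      unfold fillDist1
      linarith)
  have hmem : a + y ∈ Set.Icc a (a + 1) := ⟨by linarith [hy01.1], by linarith [hy01.2]⟩
  refine (csInf_le (hbdd _ _ _) ⟨a + y, hX y hy, hmem, rfl⟩).trans ?_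
  rw [Real.dist_eq] at hxt
  have h3 := abs_add_le (x - a - t) (t - y)
  rw [show x - a - t + (t - y) = x - (a + y) by ring] at h3
  linarith

lemma fillDist1_Icc_pos {X : Finset ℝ} {a : ℝ} (hX : ∃ y ∈ X, y ∈ Set.Icc a (a + 1)) :
    0 < fillDist1 X (Set.Icc a (a + 1)) := by
  obtain ⟨y₀, hy₀, hy₀'⟩ := hX
  have hfin : ∀ x, {r : ℝ | ∃ y ∈ X, y ∈ Set.Icc a (a + 1) ∧ r = |x - y|}.Finite := by
    intro x
    refine (X.finite_toSet.image fun y => |x - y|).subset ?_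
    rintro _ ⟨y, hy, -, rfl⟩
    exact ⟨y, hy, rfl⟩
  obtain ⟨x, hx, hxX⟩ := ((Set.Icc_infinite (lt_add_one a)).sdiff X.finite_toSet).nonempty
  have hup : BddAbove {h : ℝ | ∃ x ∈ Set.Icc a (a + 1),
      h = sInf {r : ℝ | ∃ y ∈ X, y ∈ Set.Icc a (a + 1) ∧ r = |x - y|}} := by
    refine ⟨1, ?_⟩
    rintro _ ⟨x, hx, rfl⟩
    refine (csInf_le (hfin x).bddBelow ⟨y₀, hy₀, hy₀', rfl⟩).trans ?_
    rw [abs_le]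
    constructor <;> linarith [hx.1, hx.2, hy₀'.1, hy₀'.2]
  refine lt_of_lt_of_le ?_ (le_csSup hup ⟨x, hx, rfl⟩)
  have hne : {r : ℝ | ∃ y ∈ X, y ∈ Set.Icc a (a + 1) ∧ r = |x - y|}.Nonempty :=
    ⟨_, y₀, hy₀, hy₀', rfl⟩
  obtain ⟨y, hy, -, hr⟩ := hne.csInf_mem (hfin x)
  rw [hr, abs_pos, sub_ne_zero]
  rintro rfl
  exact hxX hy

lemma log_div_self_le_of_le {h H : ℝ} (hh : 0 < h) (hH : h ≤ H) (hH1 : H ≤ 1) :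
    Real.log h / h ≤ Real.log H / H := by
  have hH0 := hh.trans_le hH
  rw [div_le_div_iff₀ hh hH0]
  have h1 : Real.log h ≤ Real.log H := Real.log_le_log hh hH
  have h2 : Real.log H ≤ 0 := Real.log_nonpos hH0.le hH1
  nlinarith

lemma exists_translate_subset_Xk (Y : ℕ → Finset ℝ) {k : ℕ} {j : ℤ}
    (hj : -((k / 2 : ℕ) : ℤ) ≤ j) (hj' : j < ((k / 2 : ℕ) : ℤ)) :
    ∃ m, 1 ≤ m ∧ m ≤ k / 2 ∧ ∀ y ∈ Y (k - m + 1), (j : ℝ) + y ∈ Xk Y k := by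
  rcases le_or_gt 0 j with h | h
  · lift j to ℕ using h
    refine ⟨j + 1, by omega, by omega, fun y hy => ?_⟩
    refine Finset.mem_biUnion.2 ⟨j + 1, Finset.mem_Icc.2 ⟨by omega, by omega⟩, ?_⟩
    refine Finset.mem_union_left _ (Finset.mem_image.2 ⟨y, hy, ?_⟩)
    push_cast
    ring
  · obtain ⟨m, rfl⟩ : ∃ m : ℕ, j = -(m : ℤ) := ⟨j.natAbs, by omega⟩
    refine ⟨m, by omega, by omega, fun y hy => ?_⟩
    refine Finset.mem_biUnion.2 ⟨m, Finset.mem_Icc.2 ⟨by omega, by omega⟩, ?_⟩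
    refine Finset.mem_union_right _ (Finset.mem_image.2 ⟨y, hy, ?_⟩)
    push_cast
    ring

lemma Igauss_power1_le {α ℓ : ℝ} (hα : 0 < α) (hℓ : 0 < ℓ) (X : Finset ℝ) (M : ℕ) {E : ℝ}
    (hE : ∀ j : ℤ, -(M : ℤ) ≤ j → j < M →
      ∫ x in Set.Icc (j : ℝ) (j + 1), power1 ℓ X x ≤ E) :
    Igauss α (power1 ℓ X) ≤ (Real.sqrt (2 * Real.pi) * α)⁻¹ *
      (2 * M * E + Real.exp (-(M : ℝ) ^ 2 / (4 * α ^ 2)) *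
        (Real.sqrt (2 * Real.pi) * (Real.sqrt 2 * α))) := by
  have hP := continuous_power1 hℓ X
  have h2 : (0 : ℝ) < Real.sqrt 2 * α := by positivity
  have hind : ∀ j ∈ Finset.Ico (-(M : ℤ)) M,
      Integrable ((Set.Icc (j : ℝ) (j + 1)).indicator (power1 ℓ X)) := fun j _ =>
    (integrable_indicator_iff measurableSet_Icc).2 (hP.integrableOn_Icc)
  unfold Igauss
  gcongr
  calc ∫ x, power1 ℓ X x * Real.exp (-x ^ 2 / (2 * α ^ 2))
      ≤ ∫ x, (∑ j ∈ Finset.Ico (-(M : ℤ)) M,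
            (Set.Icc (j : ℝ) (j + 1)).indicator (power1 ℓ X) x) +
          Real.exp (-(M : ℝ) ^ 2 / (4 * α ^ 2)) *
            Real.exp (-x ^ 2 / (2 * (Real.sqrt 2 * α) ^ 2)) := by
        refine integral_mono ?_ ?_ fun x => ?_
        · refine integrable_mul_gauss_weight hα hP (B := 1) fun x => ?_
          rw [abs_of_nonneg (power1_nonneg hℓ X x)]
          exact power1_le_one hℓ X x
        · exact (integrable_finsetSum _ hind).add ((integrable_gauss_weight h2).const_mul _)
        · have hnn : ∀ j ∈ Finset.Ico (-(M : ℤ)) M,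
              0 ≤ (Set.Icc (j : ℝ) (j + 1)).indicator (power1 ℓ X) x := fun j _ =>
            Set.indicator_nonneg (fun _ _ => power1_nonneg hℓ X _) _
          beta_reduce
          by_cases hx : -(M : ℤ) ≤ ⌊x⌋ ∧ ⌊x⌋ < M
          · have h1 := Finset.single_le_sum hnn (Finset.mem_Ico.2 hx)
            have hxI : x ∈ Set.Icc (⌊x⌋ : ℝ) (⌊x⌋ + 1) :=
              ⟨Int.floor_le x, (Int.lt_floor_add_one x).le⟩
            rw [Set.indicator_of_mem hxI] at h1
            have h3 : power1 ℓ X x * Real.exp (-x ^ 2 / (2 * α ^ 2)) ≤ power1 ℓ X x := by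
              refine mul_le_of_le_one_right (power1_nonneg hℓ X x) (Real.exp_le_one_iff.2 ?_)
              rw [neg_div]
              exact neg_nonpos.2 (by positivity)
            exact (h3.trans h1).trans (le_add_of_nonneg_right (by positivity))
          · have hMx : (M : ℝ) ^ 2 ≤ x ^ 2 := by
              rw [not_and_or, not_le, not_lt, Int.floor_lt, Int.le_floor] at hx
              push_cast at hx
              have : (0 : ℝ) ≤ M := by positivity
              rcases hx with hx | hx <;> nlinarith
            refine le_trans ?_ (le_add_of_nonneg_left (Finset.sum_nonneg hnn))
            refine (mul_le_of_le_one_left (Real.exp_pos _).le (power1_le_one hℓ X x)).trans ?_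
            rw [← Real.exp_add, Real.exp_le_exp, mul_pow, Real.sq_sqrt (by norm_num),
              show 2 * (2 * α ^ 2) = 4 * α ^ 2 by ring, ← add_div,
              div_le_div_iff₀ (by positivity) (by positivity)]
            nlinarith [mul_le_mul_of_nonneg_left hMx (sq_nonneg α)]
    _ = (∑ j ∈ Finset.Ico (-(M : ℤ)) M, ∫ x in Set.Icc (j : ℝ) (j + 1), power1 ℓ X x) +
          Real.exp (-(M : ℝ) ^ 2 / (4 * α ^ 2)) *
            (Real.sqrt (2 * Real.pi) * (Real.sqrt 2 * α)) := by
        rw [integral_add (integrable_finsetSum _ hind)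
          ((integrable_gauss_weight h2).const_mul _), integral_finsetSum _ hind,
          integral_const_mul, gauss_normalization h2]
        simp_rw [integral_indicator measurableSet_Icc]
    _ ≤ _ := by
        gcongr
        refine (Finset.sum_le_card_nsmul _ _ E fun j hj => ?_).trans_eq ?_
        · exact hE j (Finset.mem_Ico.1 hj).1 (Finset.mem_Ico.1 hj).2
        · rw [Int.card_Ico, nsmul_eq_mul, show ((M : ℤ) - -(M : ℤ)).toNat = 2 * M by omega]
          push_cast
          ring

lemma Igauss_power1_le_one {α ℓ : ℝ} (hα : 0 < α) (hℓ : 0 < ℓ) (X : Finset ℝ) :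
    Igauss α (power1 ℓ X) ≤ 1 := by
  unfold Igauss
  rw [inv_mul_le_iff₀ (by positivity), mul_one, ← gauss_normalization hα]
  refine integral_mono (integrable_mul_gauss_weight hα (continuous_power1 hℓ X) (B := 1)
    fun x => ?_) (integrable_gauss_weight hα) fun x => ?_
  · rw [abs_of_nonneg (power1_nonneg hℓ X x)]
    exact power1_le_one hℓ X x
  · exact mul_le_of_le_one_left (Real.exp_pos _).le (power1_le_one hℓ X x)

lemma eventually_sampling_term_le {C cqu : ℝ} (hC : 0 < C) (hcqu : 0 < cqu) (b : ℝ) :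
    ∀ᶠ k : ℕ in atTop, 2 * ((k / 2 : ℕ) : ℝ) *
      Real.exp (C * (Real.log (2 * cqu / k) / (2 * cqu / k))) ≤ Real.exp (-(b * k)) := by
  have hlog : Tendsto (fun k : ℕ => Real.log ((k : ℝ) / (2 * cqu))) atTop atTop :=
    Real.tendsto_log_atTop.comp
      (tendsto_natCast_atTop_atTop.atTop_div_const (by positivity))
  filter_upwards [hlog.eventually_ge_atTop ((1 + b) * (2 * cqu) / C), eventually_gt_atTop 0]
    with k hk hk0
  have hk0' : (0 : ℝ) < k := by exact_mod_cast hk0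
  have h1 : 2 * ((k / 2 : ℕ) : ℝ) ≤ Real.exp k := by
    have h : 2 * ((k / 2 : ℕ) : ℝ) ≤ k := by exact_mod_cast Nat.mul_div_le k 2
    linarith [Real.add_one_le_exp (k : ℝ)]
  have h2 : C * (Real.log (2 * cqu / k) / (2 * cqu / k)) ≤ -((1 + b) * k) := by
    rw [← inv_div (k : ℝ) (2 * cqu), Real.log_inv, div_inv_eq_mul]
    rw [div_le_iff₀ hC] at hk
    have h3 := mul_le_mul_of_nonneg_right hk (show 0 ≤ (k : ℝ) / (2 * cqu) by positivity)
    have h4 : (1 + b) * (2 * cqu) * ((k : ℝ) / (2 * cqu)) = (1 + b) * k := by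
      field_simp
    linarith
  calc _ ≤ Real.exp k * Real.exp (-((1 + b) * k)) :=
        mul_le_mul h1 (Real.exp_le_exp.2 h2) (Real.exp_pos _).le (Real.exp_pos _).le
    _ = _ := by
        rw [← Real.exp_add]
        congr 1
        ring

lemma eventually_tail_term_le {α : ℝ} (hα : 0 < α) (b : ℝ) :
    ∀ᶠ k : ℕ in atTop,
      Real.exp (-((k / 2 : ℕ) : ℝ) ^ 2 / (4 * α ^ 2)) ≤ Real.exp (-(b * k)) := by
  filter_upwards [tendsto_natCast_atTop_atTop.eventually_ge_atTop (64 * α ^ 2 * b),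
    eventually_ge_atTop 2] with k hk hk2
  have hM : (k : ℝ) ≤ 4 * ((k / 2 : ℕ) : ℝ) := by
    have : k ≤ 4 * (k / 2) := by omega
    exact_mod_cast this
  have hk0 : (0 : ℝ) ≤ k := by positivity
  rw [Real.exp_le_exp, div_le_iff₀ (by positivity)]
  have h1 := mul_le_mul_of_nonneg_right hk hk0
  have h2 := mul_le_mul hM hM hk0 (by positivity)
  nlinarith

lemma setIntegral_power1_Xk_le {ℓ C h₀ cqu : ℝ} (hC : 0 < C)
    (hh₀ : h₀ ∈ Set.Ioc (0 : ℝ) 1) (hcqu : 0 < cqu)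
    (hsamp : ∀ (a : ℝ) (X : Finset ℝ), (∃ y ∈ X, y ∈ Set.Icc a (a + 1)) →
      fillDist1 X (Set.Icc a (a + 1)) ≤ h₀ →
      (∫ x in Set.Icc a (a + 1), power1 ℓ X x)
        ≤ Real.exp (C * Real.log (fillDist1 X (Set.Icc a (a + 1))) /
            fillDist1 X (Set.Icc a (a + 1))))
    {Y : ℕ → Finset ℝ}
    (hY : ∀ m, 1 ≤ m → (Y m : Set ℝ) ⊆ Set.Ioo (0 : ℝ) 1 ∧ (Y m).card = m ∧
      fillDist1 (Y m) (Set.Ioo 0 1) ≤ cqu / (m : ℝ))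
    {k : ℕ} (hk0 : 0 < k) (hk : 2 * cqu / k ≤ h₀) (j : ℤ) (hj : -((k / 2 : ℕ) : ℤ) ≤ j)
    (hj' : j < ((k / 2 : ℕ) : ℤ)) :
    ∫ x in Set.Icc (j : ℝ) (j + 1), power1 ℓ (Xk Y k) x ≤
      Real.exp (C * (Real.log (2 * cqu / k) / (2 * cqu / k))) := by
  obtain ⟨m, hm1, hmk, hm⟩ := exists_translate_subset_Xk Y hj hj'
  obtain ⟨hsub, hcard, hfill⟩ := hY (k - m + 1) (by omega)
  have hne : (Y (k - m + 1)).Nonempty := Finset.card_pos.1 (by omega)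
  have hmeet : ∃ y ∈ Xk Y k, y ∈ Set.Icc (j : ℝ) (j + 1) := by
    obtain ⟨y, hy⟩ := hne
    have := hsub hy
    exact ⟨_, hm y hy, by linarith [this.1], by linarith [this.2]⟩
  have hle : fillDist1 (Xk Y k) (Set.Icc (j : ℝ) (j + 1)) ≤ 2 * cqu / k := by
    refine (fillDist1_translate_le hne hsub hm).trans (hfill.trans ?_)
    have h1 : (k : ℝ) ≤ 2 * ((k - m + 1 : ℕ) : ℝ) := by
      have : k ≤ 2 * (k - m + 1) := by omega
      exact_mod_cast this
    rw [div_le_div_iff₀ (by positivity) (by positivity)]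
    nlinarith
  refine (hsamp _ _ hmeet (hle.trans hk)).trans (Real.exp_le_exp.2 ?_)
  rw [mul_div_assoc]
  exact mul_le_mul_of_nonneg_left
    (log_div_self_le_of_le (fillDist1_Icc_pos hmeet) hle (hk.trans hh₀.2)) hC.le

/-- with n̄_m = m (so #X_k = k(k+1)), the optimal-weight worst-case error decays
as exp(−√n/(2√2 α²)). -/
theorem stmt15 (α ℓ C h₀ cqu : ℝ) (hα : 0 < α) (hℓ : 0 < ℓ) (hC : 0 < C)
    (hh₀ : h₀ ∈ Set.Ioc (0 : ℝ) 1) (hcqu : 0 < cqu)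
    (hsamp : ∀ (a : ℝ) (X : Finset ℝ), (∃ y ∈ X, y ∈ Set.Icc a (a + 1)) →
      fillDist1 X (Set.Icc a (a + 1)) ≤ h₀ →
      (∫ x in Set.Icc a (a + 1), power1 ℓ X x)
        ≤ Real.exp (C * Real.log (fillDist1 X (Set.Icc a (a + 1))) /
            fillDist1 X (Set.Icc a (a + 1)))) :
    ∃ C' : ℝ, 0 < C' ∧
      ∀ Y : ℕ → Finset ℝ,
        (∀ m, 1 ≤ m → (Y m : Set ℝ) ⊆ Set.Ioo (0 : ℝ) 1 ∧ (Y m).card = m ∧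
          fillDist1 (Y m) (Set.Ioo 0 1) ≤ cqu / (m : ℝ)) →
        ∀ k : ℕ, 2 * cqu / min h₀ cqu⁻¹ ≤ (k : ℝ) →
          eopt1 α ℓ (Xk Y k)
            ≤ C' * Real.exp (-Real.sqrt ((k : ℝ) * ((k : ℝ) + 1)) /
                (2 * Real.sqrt 2 * α ^ 2)) := by
  set a : ℝ := (2 * Real.sqrt 2 * α ^ 2)⁻¹ with ha
  have ha0 : 0 < a := by positivity
  obtain ⟨K, hK⟩ := eventually_atTop.1
    ((eventually_sampling_term_le hC hcqu (2 * a)).and (eventually_tail_term_le hα (2 * a)))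
  have hrate : ∀ k : ℕ, -(2 * a * k) ≤
      -Real.sqrt ((k : ℝ) * ((k : ℝ) + 1)) / (2 * Real.sqrt 2 * α ^ 2) := by
    intro k
    have hs : Real.sqrt ((k : ℝ) * ((k : ℝ) + 1)) ≤ 2 * k := by
      rw [Real.sqrt_le_left (by positivity)]
      rcases Nat.eq_zero_or_pos k with rfl | hk
      · simp
      · have : (1 : ℝ) ≤ k := by exact_mod_cast hk
        nlinarith
    rw [div_eq_mul_inv, ← ha]
    nlinarith [mul_le_mul_of_nonneg_right hs ha0.le]
  set D : ℝ := (Real.sqrt (2 * Real.pi) * α)⁻¹ *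
    (1 + Real.sqrt (2 * Real.pi) * (Real.sqrt 2 * α)) with hD
  have hD0 : 0 < D := by positivity
  refine ⟨D + Real.exp (2 * a * K), by positivity, fun Y hY k hk => ?_⟩
  refine (eopt1_le_Igauss_power1 hα hℓ _).trans ?_
  refine le_trans ?_ (mul_le_mul_of_nonneg_left (Real.exp_le_exp.2 (hrate k)) (by positivity))
  rw [add_mul]
  rcases lt_or_ge k K with hkK | hkK
  · refine (Igauss_power1_le_one hα hℓ _).trans (le_add_of_nonneg_of_le (by positivity) ?_)
    have : (k : ℝ) ≤ K := by exact_mod_cast hkK.le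
    rw [← Real.exp_add, Real.one_le_exp_iff]
    nlinarith
  · have hmin : 0 < min h₀ cqu⁻¹ := lt_min hh₀.1 (by positivity)
    have hk0 : (0 : ℝ) < k := lt_of_lt_of_le (by positivity) hk
    have hkh : 2 * cqu / k ≤ h₀ := by
      rw [div_le_iff₀ hmin] at hk
      rw [div_le_iff₀ hk0]
      nlinarith [min_le_left h₀ cqu⁻¹]
    obtain ⟨h1, h2⟩ := hK k hkK
    refine (Igauss_power1_le hα hℓ _ (k / 2) (setIntegral_power1_Xk_le hC hh₀ hcqu hsamp hY
      (by exact_mod_cast hk0) hkh)).trans (le_add_of_le_of_nonneg ?_ (by positivity))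
    rw [hD, mul_assoc (Real.sqrt (2 * Real.pi) * α)⁻¹, add_mul, one_mul,
      mul_comm (Real.sqrt (2 * Real.pi) * (Real.sqrt 2 * α))]
    gcongr

end
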